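/- Let ⟨{a,b}, C, d, O, v, (≺_a, ≺_b)⟩ be a two-player infinite sequential game where O = {y, x_1, …, x_n} with n ≥ 1 and all n+1 elements distinct, v : C^ω → O is surjective (every outcome is realizable), and the preferences are the strict linear orders determined by y ≺_a x_1 ≺_a … ≺_a x_n and y ≺_b x_n ≺_b … ≺_b x_1. Assume that for every O' ⊆ O, every γ ∈ C*, and every D ⊆ C*, the two-player win/lose game ⟨C, D, v^{-1}(O') ∩ γC^ω⟩ is determined. Then the game has a Pareto-optimal Nash equilibrium. -/

import Mathlib

namespace SeqGame

variable {A C O : Type*}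

/-- The length-`n` prefix of an infinite sequence, as a list. -/
def pre (p : ℕ → C) (n : ℕ) : List C := List.ofFn (fun i : Fin n => p i)

/-- The length-`n` history of the play induced by the strategy profile `σ` starting at `γ`. -/
def hist (σ : List C → C) (γ : List C) : ℕ → List C
  | 0 => []
  | n + 1 => hist σ γ n ++
      [if h : n < γ.length then γ.get ⟨n, h⟩ else σ (hist σ γ n)]

/-- The play `p^γ(σ)` induced by the strategy profile `σ` starting at `γ`. -/
def play (σ : List C → C) (γ : List C) (n : ℕ) : C :=
  if h : n < γ.length then γ.get ⟨n, h⟩ else σ (hist σ γ n)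

/-- `σ'` is an `a`-deviation of the strategy profile `σ`. -/
def Dev (d : List C → A) (a : A) (σ σ' : List C → C) : Prop :=
  ∀ h : List C, d h ≠ a → σ' h = σ h

/-- `r` is a strict linear order: irreflexive, transitive and total. -/
def SLO (r : O → O → Prop) : Prop :=
  (∀ x, ¬ r x x) ∧ (∀ x y z, r x y → r y z → r x z) ∧
  (∀ x y, x = y ∨ r x y ∨ r y x)

/-- `γ C^ω`: the set of plays extending the finite sequence `γ`. -/
def ext (γ : List C) : Set (ℕ → C) := {p | pre p γ.length = γ}

/-- The two-player win/lose game `⟨C, D, W⟩` is determined. -/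
def Determined (D : Set (List C)) (W : Set (ℕ → C)) : Prop :=
  (∃ s : List C → C, ∀ p : ℕ → C, (∀ n, pre p n ∈ D → p n = s (pre p n)) → p ∈ W) ∨
  (∃ t : List C → C, ∀ p : ℕ → C, (∀ n, pre p n ∉ D → p n = t (pre p n)) → p ∉ W)

/-- Preferences of the two players (`true` is player `a`, `false` is player `b`). -/
def rel2 (rA rB : O → O → Prop) : Bool → O → O → Prop
  | true => rA
  | false => rB

/-- The outcome `o` is Pareto-optimal: no other realizable outcome `q` is such that some
player prefers `q` to `o` while no player prefers `o` to `q`. -/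
def ParetoOpt (v : (ℕ → C) → O) (prec : A → O → O → Prop) (o : O) : Prop :=
  ¬ ∃ q : O, q ≠ o ∧ (∃ p : ℕ → C, v p = q) ∧
    (∃ c : A, prec c o q) ∧ (∀ c : A, ¬ prec c q o)

end SeqGame

namespace SeqGame

section Plays

variable {C : Type*}

@[simp]
theorem length_pre (p : ℕ → C) (n : ℕ) : (pre p n).length = n := by
  simp [pre]

theorem pre_succ (p : ℕ → C) (n : ℕ) : pre p (n + 1) = pre p n ++ [p n] := by
  rw [pre, List.ofFn_succ_last]; rfl

theorem pre_eq_pre_iff {p q : ℕ → C} {n : ℕ} :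
    pre p n = pre q n ↔ ∀ i < n, p i = q i := by
  simp only [pre, List.ofFn_inj, funext_iff]
  exact ⟨fun h i hi => h ⟨i, hi⟩, fun h i => h i i.2⟩

theorem hist_eq_pre (σ : List C → C) (γ : List C) (n : ℕ) :
    hist σ γ n = pre (play σ γ) n := by
  induction n with
  | zero => simp [hist, pre]
  | succ n ih => rw [pre_succ, ← ih, hist]; rfl

theorem pre_play_length (σ : List C → C) (γ : List C) :
    pre (play σ γ) γ.length = γ := by
  apply List.ext_getElem
  · simp
  · intro i h₁ h₂
    simp [pre, play]

theorem play_of_length_le (σ : List C → C) (γ : List C) {n : ℕ} (hn : γ.length ≤ n) :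
    play σ γ n = σ (pre (play σ γ) n) := by
  rw [← hist_eq_pre]
  simp [play, Nat.not_lt.2 hn]

theorem play_nil_apply (σ : List C → C) (n : ℕ) :
    play σ [] n = σ (pre (play σ []) n) :=
  play_of_length_le σ [] (Nat.zero_le n)

theorem eq_of_follows_of_agree {σ : List C → C} {p q : ℕ → C} {n : ℕ}
    (hp : ∀ i < n, p i = σ (pre p i)) (hq : ∀ i < n, q i = σ (pre q i)) :
    ∀ i < n, p i = q i := by
  intro i
  induction i using Nat.strong_induction_on with
  | _ i ih =>
    intro hi
    rw [hp i hi, hq i hi, pre_eq_pre_iff.2 fun j hj => ih j hj (hj.trans hi)]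

end Plays

section Forcing

variable {C O : Type*}

/-- Player `X` has a strategy which, from the position `γ` on, guarantees an outcome in `S`. -/
def CanForce (d : List C → Bool) (v : (ℕ → C) → O) (X : Bool) (γ : List C) (S : Set O) : Prop :=
  ∃ s : List C → C, ∀ p : ℕ → C, pre p γ.length = γ →
    (∀ n, γ.length ≤ n → d (pre p n) = X → p n = s (pre p n)) → v p ∈ S

variable {d : List C → Bool} {v : (ℕ → C) → O}

theorem CanForce.mono {X : Bool} {γ : List C} {S T : Set O} (h : CanForce d v X γ S)
    (hST : S ⊆ T) : CanForce d v X γ T :=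
  let ⟨s, hs⟩ := h
  ⟨s, fun p hp hf => hST (hs p hp hf)⟩

theorem canForce_or_canForce_compl
    (hdet : ∀ (O' : Set O) (γ : List C) (D : Set (List C)),
      Determined D (v ⁻¹' O' ∩ ext γ)) (X : Bool) (γ : List C) (S : Set O) :
    CanForce d v X γ S ∨ CanForce d v (!X) γ Sᶜ := by
  rcases hdet S γ {h | d h = X ∨ h.length < γ.length} with ⟨s, hs⟩ | ⟨t, ht⟩
  · refine .inl ⟨s, fun p hp hf => (hs p fun n hn => ?_).1⟩
    rcases lt_or_ge n γ.length with h | h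
    · have hq : pre (play s []) γ.length = γ := (hs _ fun n _ => play_nil_apply s n).2
      have hpq := pre_eq_pre_iff.1 (hp.trans hq.symm)
      rw [hpq n h, play_nil_apply, pre_eq_pre_iff.2 fun i hi => hpq i (hi.trans h)]
    · exact hf n h (by simpa [Nat.not_lt.2 h] using hn)
  · refine .inr ⟨t, fun p hp hf hS => ht p (fun n hn => ?_) ⟨hS, hp⟩⟩
    simp only [Set.mem_ofPred_eq, length_pre, not_or, not_lt] at hn
    exact hf n hn.2 (by simpa [Bool.eq_not] using hn.1)

theorem CanForce.along {X : Bool} {γ : List C} {S : Set O} {s : List C → C}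
    (hs : ∀ p : ℕ → C, pre p γ.length = γ →
      (∀ n, γ.length ≤ n → d (pre p n) = X → p n = s (pre p n)) → v p ∈ S)
    {p : ℕ → C} (hp : pre p γ.length = γ) {n : ℕ} (hn : γ.length ≤ n)
    (hf : ∀ m, γ.length ≤ m → m < n → d (pre p m) = X → p m = s (pre p m))
    (hd : d (pre p n) ≠ X) (c : C) : CanForce d v X (pre p n ++ [c]) S := by
  refine ⟨s, fun q hq hqf => ?_⟩
  simp only [List.length_append, length_pre, List.length_cons, List.length_nil, zero_add,
    pre_succ] at hq hqf
  have hqp : ∀ i < n, q i = p i :=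
    pre_eq_pre_iff.1 (List.append_inj hq (by simp)).1
  have hpre : ∀ m ≤ n, pre q m = pre p m := fun m hm =>
    pre_eq_pre_iff.2 fun i hi => hqp i (hi.trans_le hm)
  refine hs q ((hpre _ hn).trans hp) fun m hm hX => ?_
  rcases lt_trichotomy m n with h | rfl | h
  · rw [hqp m h, hpre m h.le]
    exact hf m hm h (hpre m h.le ▸ hX)
  · exact absurd (hpre m le_rfl ▸ hX) hd
  · exact hqf m h hX

theorem CanForce.snoc {X : Bool} {p : ℕ → C} {n : ℕ} {S : Set O}
    (h : CanForce d v X (pre p n) S) (hd : d (pre p n) ≠ X) (c : C) :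
    CanForce d v X (pre p n ++ [c]) S := by
  obtain ⟨s, hs⟩ := h
  exact CanForce.along hs (by simp) (by simp)
    (fun m hm hmn => absurd hmn (by simpa using hm)) hd c

/-- If each player can force a set of outcomes from `γ`, then some play through `γ` has its
outcome in both sets, and after `γ` every departure from it can be answered by the opponent
forcing their own set. -/
theorem exists_play_of_canForce {X : Bool} {γ : List C} {S T : Set O}
    (hS : CanForce d v X γ S) (hT : CanForce d v (!X) γ T) :
    ∃ p : ℕ → C, pre p γ.length = γ ∧ v p ∈ S ∧ v p ∈ T ∧ ∀ n, γ.length ≤ n → ∀ c,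
      (d (pre p n) = X → CanForce d v (!X) (pre p n ++ [c]) T) ∧
      (d (pre p n) = !X → CanForce d v X (pre p n ++ [c]) S) := by
  obtain ⟨s, hs⟩ := hS
  obtain ⟨t, ht⟩ := hT
  let σ : List C → C := fun h => if d h = X then s h else t h
  have hγ := pre_play_length σ γ
  have hsf : ∀ n, γ.length ≤ n → d (pre (play σ γ) n) = X →
      play σ γ n = s (pre (play σ γ) n) := fun n hn hd => by
    rw [play_of_length_le σ γ hn]; simp [σ, hd]
  have htf : ∀ n, γ.length ≤ n → d (pre (play σ γ) n) = !X →
      play σ γ n = t (pre (play σ γ) n) := fun n hn hd => by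
    rw [play_of_length_le σ γ hn]; simp [σ, hd]
  exact ⟨play σ γ, hγ, hs _ hγ hsf, ht _ hγ htf, fun n hn c =>
    ⟨fun hd => CanForce.along ht hγ hn (fun m hm _ => htf m hm) (by simp [hd]) c,
      fun hd => CanForce.along hs hγ hn (fun m hm _ => hsf m hm) (by simp [hd]) c⟩⟩

/-- A play all of whose departures can be punished is induced by a Nash equilibrium. -/
theorem exists_nash_of_punishable {R : Bool → O → O → Prop} (p : ℕ → C)
    (hirr : ∀ X, ¬ R X (v p) (v p))
    (hpun : ∀ n c, CanForce d v (!d (pre p n)) (pre p n ++ [c])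
      {o | ¬ R (d (pre p n)) (v p) o}) :
    ∃ σ : List C → C, play σ [] = p ∧ ∀ (X : Bool) (σ' : List C → C), Dev d X σ σ' →
      ¬ R X (v p) (v (play σ' [])) := by
  classical
  choose s hs using hpun
  let P : List C → ℕ × C → Prop := fun h r => ∃ q : ℕ → C, pre q h.length = h ∧
    r.1 < h.length ∧ (∀ i < r.1, q i = p i) ∧ q r.1 = r.2 ∧ r.2 ≠ p r.1
  let σ : List C → C := fun h =>
    if hd : ∃ r, P h r then s hd.choose.1 hd.choose.2 h else p h.length
  have hσp : ∀ n, σ (pre p n) = p n := by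
    intro n
    have : ¬ ∃ r, P (pre p n) r := by
      rintro ⟨r, q, hq, hr, -, hc, hne⟩
      rw [length_pre] at hq hr
      exact hne (hc ▸ pre_eq_pre_iff.1 hq _ hr)
    exact (dif_neg this).trans (by rw [length_pre])
  have hσq : ∀ (q : ℕ → C) (m k : ℕ), m < k → (∀ i < m, q i = p i) → q m ≠ p m →
      σ (pre q k) = s m (q m) (pre q k) := by
    intro q m k hmk hq hm
    have hex : ∃ r, P (pre q k) r := ⟨(m, q m), q, by simp, by simpa using hmk, hq, rfl, hm⟩
    have huniq : ∀ r, P (pre q k) r → r = (m, q m) := by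
      rintro ⟨m', c⟩ ⟨q', hq', hr, hlt, hc, hne⟩
      rw [length_pre] at hq' hr
      have hqq := pre_eq_pre_iff.1 hq'
      dsimp only at hr hlt hc hne
      subst hc
      have : m' = m := by
        rcases lt_trichotomy m' m with h | h | h
        · exact absurd ((hqq m' hr).trans (hq m' h)) hne
        · exact h
        · exact absurd ((hqq m hmk).symm.trans (hlt m h)) hm
      subst this
      rw [hqq _ hr]
    have hch := huniq _ hex.choose_spec
    simp only [σ, dif_pos hex, hch]
  refine ⟨σ, ?_, fun X σ' hdev => ?_⟩
  · funext n
    exact eq_of_follows_of_agree (fun i _ => play_nil_apply σ i) (fun i _ => (hσp i).symm) n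
      n.lt_succ_self
  · by_cases hqp : play σ' [] = p
    · exact hqp ▸ hqp.symm ▸ hirr X
    · set q := play σ' [] with hqdef
      have hex : ∃ m, q m ≠ p m := Function.ne_iff.1 hqp
      obtain ⟨m, hm, hlt⟩ : ∃ m, q m ≠ p m ∧ ∀ i < m, q i = p i :=
        ⟨Nat.find hex, Nat.find_spec hex, fun i hi => not_not.1 (Nat.find_min hex hi)⟩
      have hpre : pre q m = pre p m := pre_eq_pre_iff.2 hlt
      have hX : d (pre p m) = X := by
        by_contra hX
        apply hm
        rw [hqdef, play_nil_apply, ← hqdef, hpre, hdev _ hX, hσp]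
      have := hs m (q m) q (by simp [pre_succ, hpre]) fun k hk hdk => by
        have hk' : m < k := by simpa using hk
        rw [hX] at hdk
        rw [← hσq q m k hk' hlt hm, hqdef, play_nil_apply, ← hqdef]
        exact hdev _ (by simp [hdk])
      rwa [hX] at this

/-- If the players rank the outcomes oppositely, except for an outcome `y` that is worst for
both, then some Nash equilibrium avoids `y`. -/
theorem exists_nash_ne_worst
    (hdet : ∀ (O' : Set O) (γ : List C) (D : Set (List C)),
      Determined D (v ⁻¹' O' ∩ ext γ))
    (f : Bool → O → ℕ) (N : ℕ) (y : O) (hf0 : ∀ X o, f X o = 0 ↔ o = y)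
    (hfN : ∀ X o, o ≠ y → f X o + f (!X) o = N) (hne : ∃ p, v p ≠ y) :
    ∃ σ : List C → C, v (play σ []) ≠ y ∧ ∀ (X : Bool) (σ' : List C → C), Dev d X σ σ' →
      f X (v (play σ' [])) ≤ f X (v (play σ [])) := by
  classical
  suffices h : ∃ p, v p ≠ y ∧ ∀ n c, CanForce d v (!d (pre p n)) (pre p n ++ [c])
      {o | ¬ f (d (pre p n)) (v p) < f (d (pre p n)) o} by
    obtain ⟨p, hpy, hpun⟩ := h
    obtain ⟨σ, rfl, hσ⟩ := exists_nash_of_punishable (R := fun X o o' => f X o < f X o') p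
      (fun X => lt_irrefl _) hpun
    exact ⟨σ, hpy, fun X σ' h => not_lt.1 (hσ X σ' h)⟩
  have punish_worst : ∀ (p : ℕ → C) (n : ℕ), (∀ X, CanForce d v X (pre p n) {y}) →
      ∀ c, CanForce d v (!d (pre p n)) (pre p n ++ [c])
        {o | ¬ f (d (pre p n)) (v p) < f (d (pre p n)) o} := by
    intro p n h c
    refine ((h _).snoc (by simp) c).mono ?_
    rintro o rfl
    simp [(hf0 _ o).2 rfl]
  by_cases hall : ∀ γ X, CanForce d v X γ {y}
  · obtain ⟨p, hp⟩ := hne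
    exact ⟨p, hp, fun n => punish_worst p n fun X => hall _ X⟩
  have hex : ∃ l, ∃ γ : List C, γ.length = l ∧ ∃ X, ¬ CanForce d v (!X) γ {y} := by
    push Not at hall
    obtain ⟨γ, X, h⟩ := hall
    exact ⟨_, γ, rfl, !X, by simpa using h⟩
  obtain ⟨γ, hγ, X, hX⟩ := Nat.find_spec hex
  have hmin : ∀ h : List C, h.length < γ.length → ∀ Y, CanForce d v Y h {y} := by
    intro h hh Y
    by_contra hY
    exact Nat.find_min hex (hγ ▸ hh) ⟨h, rfl, !Y, by simpa using hY⟩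
  have hfle : ∀ o, f X o ≤ N := fun o => by
    by_cases ho : o = y
    · simp [(hf0 X o).2 ho]
    · exact hfN X o ho ▸ Nat.le_add_right _ _
  have hk : ∃ k, CanForce d v (!X) γ {o | f X o ≤ k} :=
    ⟨N, fun _ => hne.choose 0, fun p _ _ => hfle _⟩
  obtain ⟨k, hT, hS⟩ : ∃ k, CanForce d v (!X) γ {o | f X o ≤ k + 1} ∧
      CanForce d v X γ {o | k + 1 ≤ f X o} := by
    have h0 : Nat.find hk ≠ 0 := fun h0 => by
      have := Nat.find_spec hk
      rw [h0] at this
      exact hX (this.mono fun o ho => (hf0 X o).1 (Nat.le_zero.1 ho))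
    obtain ⟨k, hkk⟩ := Nat.exists_eq_succ_of_ne_zero h0
    refine ⟨k, ?_, ?_⟩
    · have := Nat.find_spec hk
      rwa [hkk] at this
    · have hn := Nat.find_min hk (m := k) (by omega)
      refine ((canForce_or_canForce_compl hdet X γ {o | k + 1 ≤ f X o}).resolve_right
        fun h => hn (h.mono fun o ho => ?_))
      simpa [Nat.lt_succ_iff] using ho
  obtain ⟨p, hpγ, hpS, hpT, hp⟩ := exists_play_of_canForce hS hT
  simp only [Set.mem_ofPred_eq] at hpS hpT
  have hpy : v p ≠ y := fun h => by
    have := (hf0 X _).2 h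
    omega
  refine ⟨p, hpy, fun n c => ?_⟩
  rcases lt_or_ge n γ.length with h | h
  · exact punish_worst p n (hmin _ (by simpa using h)) c
  by_cases hd : d (pre p n) = X
  · rw [hd]
    exact ((hp n h c).1 hd).mono fun o (ho : f X o ≤ k + 1) => by
      simp only [Set.mem_ofPred_eq]; omega
  · have hd' : d (pre p n) = !X := by simpa [Bool.eq_not] using hd
    rw [hd', Bool.not_not]
    refine ((hp n h c).2 hd').mono fun o (ho : k + 1 ≤ f X o) => ?_
    have hoy : o ≠ y := fun h => by
      have := (hf0 X _).2 h
      omega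
    have h1 := hfN X _ hpy
    have h2 := hfN X o hoy
    simp only [Set.mem_ofPred_eq]
    omega

end Forcing

end SeqGame

open SeqGame in
/-- a two-player infinite sequential game with outcomes `{y, x_1, …, x_n}`,
preferences `y ≺_a x_1 ≺_a … ≺_a x_n` and `y ≺_b x_n ≺_b … ≺_b x_1` (player `a` is
`true`, player `b` is `false`), all outcomes realizable, and determinacy of the induced
win/lose games, has a Pareto-optimal Nash equilibrium. -/
theorem stmt15 {C O : Type*} [Nonempty C]
    (n : ℕ) (hn : 1 ≤ n) (y : O) (x : Fin n → O)
    (hxinj : Function.Injective x) (hyx : y ∉ Set.range x)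
    (hall : ∀ o : O, o = y ∨ o ∈ Set.range x)
    (precA precB : O → O → Prop)
    (hA : ∀ o o', precA o o' ↔
      ((o = y ∧ o' ≠ y) ∨ ∃ i j : Fin n, i < j ∧ o = x i ∧ o' = x j))
    (hB : ∀ o o', precB o o' ↔
      ((o = y ∧ o' ≠ y) ∨ ∃ i j : Fin n, j < i ∧ o = x i ∧ o' = x j))
    (d : List C → Bool) (v : (ℕ → C) → O)
    (hv : Function.Surjective v)
    (hdet : ∀ (O' : Set O) (γ : List C) (D : Set (List C)),
      Determined D (v ⁻¹' O' ∩ ext γ)) :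
    ∃ σ : List C → C,
      (∀ (X : Bool) (σ' : List C → C), Dev d X σ σ' →
        ¬ rel2 precA precB X (v (play σ [])) (v (play σ' []))) ∧
      ParetoOpt v (rel2 precA precB) (v (play σ [])) := by
  classical
  have hxy : ∀ i, x i ≠ y := fun i h => hyx ⟨i, h⟩
  let f : Bool → O → ℕ := fun X o =>
    if h : ∃ i, x i = o then (if X then h.choose + 1 else n - h.choose) else 0
  have hfx : ∀ X i, f X (x i) = if X then (i : ℕ) + 1 else n - i := fun X i => by
    have h : ∃ j, x j = x i := ⟨i, rfl⟩
    have hi : h.choose = i := hxinj h.choose_spec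
    simp only [f, dif_pos h, hi]
  have hfy : ∀ X, f X y = 0 := fun X => dif_neg fun ⟨i, hi⟩ => hxy i hi
  have hrel : ∀ X o o', rel2 precA precB X o o' → f X o < f X o' := by
    have key : ∀ X i, 0 < f X (x i) := fun X i => by
      have := i.2
      rw [hfx]; split <;> omega
    rintro (_ | _) o o' h
    · rcases (hB o o').1 h with ⟨rfl, h⟩ | ⟨i, j, hij, rfl, rfl⟩
      · obtain ⟨i, rfl⟩ := (hall o').resolve_left h
        simpa [hfy] using key _ i
      · have := i.2
        simp only [hfx, Bool.false_eq_true, if_false]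
        omega
    · rcases (hA o o').1 h with ⟨rfl, h⟩ | ⟨i, j, hij, rfl, rfl⟩
      · obtain ⟨i, rfl⟩ := (hall o').resolve_left h
        simpa [hfy] using key _ i
      · simp only [hfx, if_true]
        omega
  obtain ⟨σ, hσy, hσ⟩ := exists_nash_ne_worst (d := d) hdet f (n + 1) y
    (fun X o => by
      rcases hall o with rfl | ⟨i, rfl⟩
      · simp [hfy]
      · have := i.2
        simp only [hxy, iff_false, hfx]
        split <;> omega)
    (fun X o ho => by
      obtain ⟨i, rfl⟩ := (hall o).resolve_left ho
      have := i.2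
      cases X <;> simp [hfx] <;> omega)
    (let ⟨p, hp⟩ := hv (x ⟨0, hn⟩); ⟨p, hp ▸ hxy _⟩)
  refine ⟨σ, fun X σ' hdev h => (hσ X σ' hdev).not_gt (hrel _ _ _ h), ?_⟩
  rintro ⟨q, hq, -, ⟨c, hc⟩, hno⟩
  obtain ⟨i, hi⟩ := (hall _).resolve_left hσy
  rw [← hi] at hq hc hno
  rcases hall q with rfl | ⟨j, rfl⟩
  · exact hno true ((hA _ _).2 (.inl ⟨rfl, hxy i⟩))
  · have hij : i ≠ j := fun h => hq (h ▸ rfl)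
    rcases hij.lt_or_gt with h | h
    · exact hno false ((hB _ _).2 (.inr ⟨j, i, h, rfl, rfl⟩))
    · exact hno true ((hA _ _).2 (.inr ⟨j, i, h, rfl, rfl⟩))
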